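/- For every real number δ > 0 there exists a positive integer I and a finite set Γ₀ ⊂ (0,1) ∩ ℚ, both depending only on δ, satisfying the following: whenever k₀ and r are positive integers with 1 ≤ k₀ ≤ r−1 and a₁, a₂, a₃, a₄, e are integers such that (i) ∑_{i=1}^4 {a_i k₀ / r} = {e k₀ / r} + k₀/r, and (ii) for every integer k with 1 ≤ k ≤ r−1 and k ≠ k₀ one has ∑_{i=1}^4 {a_i k / r} ≥ {e k / r} + k₀/r + δ, then r / gcd(r, k₀) ≤ I; in particular k₀/r ∈ Γ₀. -/

import Mathlib

/-- Simultaneous Dirichlet approximation: one bound `M` on the multiplier serves all points. -/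
theorem exists_bound_forall_exists_abs_sub_int_lt {ι : Type*} [Fintype ι] {η : ℚ} (hη : 0 < η) :
    ∃ M : ℕ, ∀ x : ι → ℚ, ∃ m : ℕ, 1 ≤ m ∧ m ≤ M ∧ ∃ p : ι → ℤ, ∀ i, |m * x i - p i| < η := by
  classical
  obtain ⟨N, hN⟩ := exists_nat_gt (1 / η)
  have hN0 : (0 : ℚ) < N := lt_trans (by positivity) hN
  have hNη : 1 / (N : ℚ) < η := by
    rw [div_lt_iff₀ hN0]
    rw [div_lt_iff₀ hη] at hN
    linarith
  refine ⟨(Fintype.piFinset fun _ : ι => Finset.Ico (0 : ℤ) N).card, fun x => ?_⟩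
  set T := Fintype.piFinset fun _ : ι => Finset.Ico (0 : ℤ) N with hT
  have hmaps : ∀ j ∈ Finset.range (T.card + 1),
      (fun i => ⌊(N : ℚ) * Int.fract ((j : ℚ) * x i)⌋) ∈ T := by
    intro j _
    rw [hT, Fintype.mem_piFinset]
    intro i
    rw [Finset.mem_Ico]
    refine ⟨Int.floor_nonneg.2 (mul_nonneg hN0.le (Int.fract_nonneg _)), Int.floor_lt.2 ?_⟩
    have := Int.fract_lt_one ((j : ℚ) * x i)
    push_cast
    nlinarith
  have key : ∀ a b : ℕ, a < b → b ≤ T.card →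
      (fun i => ⌊(N : ℚ) * Int.fract ((a : ℚ) * x i)⌋) =
        (fun i => ⌊(N : ℚ) * Int.fract ((b : ℚ) * x i)⌋) →
      ∃ m : ℕ, 1 ≤ m ∧ m ≤ T.card ∧ ∃ p : ι → ℤ, ∀ i, |m * x i - p i| < η := by
    intro a b hab hb hfl
    refine ⟨b - a, by omega, by omega, fun i => ⌊(b : ℚ) * x i⌋ - ⌊(a : ℚ) * x i⌋, fun i => ?_⟩
    have h := Int.abs_sub_lt_one_of_floor_eq_floor (congrFun hfl i)
    have e : ((b - a : ℕ) : ℚ) * x i - ((⌊(b : ℚ) * x i⌋ - ⌊(a : ℚ) * x i⌋ : ℤ) : ℚ) =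
        Int.fract ((b : ℚ) * x i) - Int.fract ((a : ℚ) * x i) := by
      rw [Nat.cast_sub hab.le, Int.fract, Int.fract]
      push_cast
      ring
    rw [e, abs_sub_comm]
    rw [← mul_sub, abs_mul, abs_of_pos hN0] at h
    refine lt_trans ?_ hNη
    rw [lt_div_iff₀ hN0]
    linarith
  obtain ⟨a, ha, b, hb, hne, hfl⟩ :=
    Finset.exists_ne_map_eq_of_card_lt_of_maps_to (by simp) hmaps
  rw [Finset.mem_range] at ha hb
  rcases lt_or_gt_of_ne hne with h | h
  · exact key a b h (by omega) hfl
  · exact key b a h (by omega) hfl.symm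

theorem Int.abs_fract_succ_mul_sub_fract_lt_of_mem_Icc {x η ε : ℚ} {m : ℕ} {p : ℤ}
    (hηε : η ≤ ε) (h : |m * x - p| < η) (h₁ : η ≤ Int.fract x) (h₂ : Int.fract x ≤ 1 - η) :
    |Int.fract ((m + 1 : ℕ) * x) - Int.fract x| < ε := by
  obtain ⟨h₃, h₄⟩ := abs_lt.1 h
  have e : Int.fract ((m + 1 : ℕ) * x) = Int.fract x + (m * x - p) := by
    rw [Int.fract_eq_iff]
    refine ⟨by linarith, by linarith, p + ⌊x⌋, ?_⟩
    rw [Int.fract]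
    push_cast
    ring
  rw [e, add_sub_cancel_left]
  exact h.trans_le hηε

theorem Int.abs_fract_succ_mul_sub_fract_lt_of_near_int {x η ε : ℚ} {m : ℕ}
    (hε : ε ≤ 1) (hη : (m + 1) * η ≤ ε) (h : Int.fract x < η ∨ 1 - η < Int.fract x) :
    |Int.fract ((m + 1 : ℕ) * x) - Int.fract x| < ε := by
  have hm : (0 : ℚ) ≤ m := m.cast_nonneg
  have h₀ := Int.fract_nonneg x
  have h₁ := Int.fract_lt_one x
  have hx := Int.floor_add_fract x
  rcases h with h | h
  · have e : Int.fract ((m + 1 : ℕ) * x) = (m + 1) * Int.fract x := by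
      rw [Int.fract_eq_iff]
      refine ⟨by positivity, by nlinarith, (m + 1) * ⌊x⌋, ?_⟩
      rw [Int.fract]
      push_cast
      ring
    rw [e, abs_lt]
    constructor <;> nlinarith
  · have e : Int.fract ((m + 1 : ℕ) * x) = 1 - (m + 1) * (1 - Int.fract x) := by
      rw [Int.fract_eq_iff]
      refine ⟨by nlinarith, by nlinarith, (m + 1) * ⌊x⌋ + m, ?_⟩
      rw [Int.fract]
      push_cast
      ring
    rw [e, abs_lt]
    constructor <;> nlinarith

theorem exists_bound_of_card_near_int_le {ι : Type*} [Fintype ι] {ε : ℚ} (hε : 0 < ε)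
    (hε₁ : ε ≤ 1) (k : ℕ) : ∀ η : ℚ, 0 < η → η ≤ ε → ∃ M : ℕ, ∀ x : ι → ℚ,
      (Finset.univ.filter fun i => Int.fract (x i) < η ∨ 1 - η < Int.fract (x i)).card < k →
      ∃ m : ℕ, 1 ≤ m ∧ m ≤ M ∧
        ∀ i, |Int.fract ((m + 1 : ℕ) * x i) - Int.fract (x i)| < ε := by
  induction k with
  | zero => exact fun η _ _ => ⟨0, fun x hx => absurd hx (Nat.not_lt_zero _)⟩
  | succ k ih =>
    intro η hη hηε
    obtain ⟨M, hM⟩ := exists_bound_forall_exists_abs_sub_int_lt (ι := ι) hη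
    have hM0 : (0 : ℚ) < M + 1 := by positivity
    set η' := min η (ε / (M + 1)) with hη'
    have hη'0 : 0 < η' := lt_min hη (by positivity)
    have hη'M : (M + 1) * η' ≤ ε := by
      have := min_le_right η (ε / (M + 1))
      rw [← hη', le_div_iff₀ hM0] at this
      linarith
    have hη'η : η' ≤ η := min_le_left _ _
    obtain ⟨M', hM'⟩ := ih η' hη'0 (hη'η.trans hηε)
    refine ⟨max M M', fun x hx => ?_⟩
    by_cases hc : (Finset.univ.filter fun i =>
        Int.fract (x i) < η' ∨ 1 - η' < Int.fract (x i)).card < k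
    · obtain ⟨m, h₁, h₂, h₃⟩ := hM' x hc
      exact ⟨m, h₁, h₂.trans (le_max_right _ _), h₃⟩
    · have heq : (Finset.univ.filter fun i =>
          Int.fract (x i) < η' ∨ 1 - η' < Int.fract (x i)) =
          Finset.univ.filter fun i => Int.fract (x i) < η ∨ 1 - η < Int.fract (x i) := by
        refine Finset.eq_of_subset_of_card_le (fun i hi => ?_) (by omega)
        simp only [Finset.mem_filter, Finset.mem_univ, true_and] at hi ⊢
        exact hi.imp (fun h => by linarith) (fun h => by linarith)
      obtain ⟨m, h₁, h₂, p, hp⟩ := hM x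
      refine ⟨m, h₁, h₂.trans (le_max_left _ _), fun i => ?_⟩
      by_cases hi : Int.fract (x i) < η ∨ 1 - η < Int.fract (x i)
      · have hi' : i ∈ Finset.univ.filter fun i =>
            Int.fract (x i) < η' ∨ 1 - η' < Int.fract (x i) := by
          rw [heq]
          simpa using hi
        refine Int.abs_fract_succ_mul_sub_fract_lt_of_near_int hε₁ ?_ (Finset.mem_filter.1 hi').2
        have : (m : ℚ) ≤ M := by exact_mod_cast h₂
        nlinarith
      · rw [not_or, not_lt, not_lt] at hi
        exact Int.abs_fract_succ_mul_sub_fract_lt_of_mem_Icc hηε (hp i) hi.1 hi.2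

/-- Uniform recurrence for fractional parts: the sawtooth coordinates of some multiple `(m + 1) x`,
with `1 ≤ m ≤ M` and `M` independent of `x`, are all close to those of `x`, with no wrapping. -/
theorem exists_bound_forall_exists_abs_fract_sub_lt {ι : Type*} [Fintype ι] {ε : ℚ}
    (hε : 0 < ε) : ∃ M : ℕ, ∀ x : ι → ℚ, ∃ m : ℕ, 1 ≤ m ∧ m ≤ M ∧
      ∀ i, |Int.fract ((m + 1 : ℕ) * x i) - Int.fract (x i)| < ε := by
  have h0 : 0 < min ε 1 := lt_min hε one_pos
  obtain ⟨M, hM⟩ := exists_bound_of_card_near_int_le (ι := ι) h0 (min_le_right _ _)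
    (Fintype.card ι + 1) _ h0 le_rfl
  refine ⟨M, fun x => ?_⟩
  obtain ⟨m, h₁, h₂, h₃⟩ := hM x (Nat.lt_succ_of_le (Finset.card_le_univ _))
  exact ⟨m, h₁, h₂, fun i => (h₃ i).trans_le (min_le_left _ _)⟩

theorem Rat.finite_setOf_pos_lt_one_den_le (I : ℕ) :
    {q : ℚ | 0 < q ∧ q < 1 ∧ q.den ≤ I}.Finite := by
  refine (((Set.finite_Icc (0 : ℤ) I).prod (Set.finite_Icc 0 I)).image
    fun p : ℤ × ℕ => (p.1 : ℚ) / p.2).subset ?_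
  rintro q ⟨h₀, h₁, h₂⟩
  refine ⟨(q.num, q.den), ⟨⟨(Rat.num_pos.2 h₀).le, ?_⟩, Nat.zero_le _, h₂⟩, Rat.num_div_den q⟩
  have : q.num < q.den := Rat.num_lt_denom_iff.2 h₁
  dsimp only
  omega

theorem Int.fract_mod_mul_div (s r : ℕ) (hr : 0 < r) (a : ℤ) :
    Int.fract (((s % r : ℕ) : ℚ) * a / r) = Int.fract ((s : ℚ) * a / r) := by
  rw [Int.fract_eq_fract]
  refine ⟨-(((s / r : ℕ) : ℤ) * a), ?_⟩
  have hr' : (r : ℚ) ≠ 0 := by positivity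
  have h : (s : ℚ) = r * (s / r : ℕ) + (s % r : ℕ) := by exact_mod_cast (Nat.div_add_mod s r).symm
  rw [h, Int.cast_neg, Int.cast_mul, Int.cast_natCast]
  field_simp
  ring


/-- For every real `δ > 0` there exist a positive integer `I` and a finite set
`Γ₀ ⊂ (0,1) ∩ ℚ`, both depending only on `δ`, such that: whenever `k₀, r` are positive
integers with `1 ≤ k₀ ≤ r − 1` and `a₁, a₂, a₃, a₄, e` are integers with
(i) `∑_{i=1}^4 {aᵢk₀/r} = {ek₀/r} + k₀/r`, and
(ii) for every integer `1 ≤ k ≤ r − 1` with `k ≠ k₀` one has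
`∑_{i=1}^4 {aᵢk/r} ≥ {ek/r} + k₀/r + δ`,
then `r / gcd(r, k₀) ≤ I`; in particular `k₀/r ∈ Γ₀`. -/
theorem transfer_to_fivefold_lemma :
    ∀ δ : ℝ, 0 < δ →
      ∃ (I : ℕ) (Γ₀ : Set ℚ), 0 < I ∧ Γ₀.Finite ∧
        (∀ q ∈ Γ₀, 0 < q ∧ q < 1) ∧
        ∀ (k₀ r : ℕ) (a : Fin 4 → ℤ) (e : ℤ),
          0 < r → 1 ≤ k₀ → k₀ ≤ r - 1 →
          ((∑ i : Fin 4, Int.fract ((k₀ : ℚ) * (a i : ℚ) / (r : ℚ)))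
            = Int.fract ((k₀ : ℚ) * (e : ℚ) / (r : ℚ)) + (k₀ : ℚ) / (r : ℚ)) →
          (∀ k : ℕ, 1 ≤ k → k ≤ r - 1 → k ≠ k₀ →
            ((Int.fract ((k : ℚ) * (e : ℚ) / (r : ℚ)) + (k₀ : ℚ) / (r : ℚ) : ℚ) : ℝ) + δ ≤
              ((∑ i : Fin 4, Int.fract ((k : ℚ) * (a i : ℚ) / (r : ℚ)) : ℚ) : ℝ)) →
          (r / Nat.gcd r k₀ ≤ I ∧ (k₀ : ℚ) / (r : ℚ) ∈ Γ₀) := by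
  intro δ hδ
  obtain ⟨ε, hε, hεδ⟩ := exists_rat_btwn (show (0 : ℝ) < δ / 5 by positivity)
  have hε0 : 0 < ε := by exact_mod_cast hε
  obtain ⟨M, hM⟩ := exists_bound_forall_exists_abs_fract_sub_lt (ι := Fin 5) hε0
  refine ⟨M + 1, {q : ℚ | 0 < q ∧ q < 1 ∧ q.den ≤ M + 1}, Nat.succ_pos M,
    Rat.finite_setOf_pos_lt_one_den_le _, fun q hq => ⟨hq.1, hq.2.1⟩, ?_⟩
  intro k₀ r a e hr hk₀ hk₀r h₁ h₂
  have hr' : (0 : ℚ) < r := by exact_mod_cast hr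
  have hbound : r / Nat.gcd r k₀ ≤ M + 1 := by
    by_contra! hlt
    obtain ⟨m, hm₁, hmM, hm⟩ := hM (Fin.cons ((k₀ : ℚ) * e / r) fun i => (k₀ : ℚ) * a i / r)
    have hdvd : ∀ l : ℕ, 0 < l → l ≤ M + 1 → ¬ r ∣ l * k₀ := by
      intro l hl₀ hl h
      have hco := Nat.coprime_div_gcd_div_gcd (Nat.gcd_pos_of_pos_left k₀ hr)
      have h' : r / Nat.gcd r k₀ ∣ l * (k₀ / Nat.gcd r k₀) := by
        rw [← Nat.mul_div_assoc _ (Nat.gcd_dvd_right r k₀)]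
        exact Nat.div_dvd_div (Nat.gcd_dvd_left r k₀) h
      exact absurd (Nat.le_of_dvd hl₀ (hco.dvd_of_dvd_mul_right h')) (by omega)
    set k := ((m + 1) * k₀) % r with hk
    have hk1 : 1 ≤ k := by
      rw [Nat.one_le_iff_ne_zero]
      exact fun h => hdvd (m + 1) m.succ_pos (by omega) (Nat.dvd_of_mod_eq_zero h)
    have hkr : k < r := Nat.mod_lt _ hr
    have hkk₀ : k ≠ k₀ := by
      intro h
      refine hdvd m hm₁ (by omega) ⟨(m + 1) * k₀ / r, ?_⟩
      have h3 := Nat.div_add_mod ((m + 1) * k₀) r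
      rw [← hk, h, add_mul, one_mul] at h3
      rw [add_mul, one_mul]
      omega
    have hfr : ∀ b : ℤ, Int.fract ((k : ℚ) * b / r) =
        Int.fract ((m + 1 : ℕ) * ((k₀ : ℚ) * b / r)) := by
      intro b
      rw [hk, Int.fract_mod_mul_div _ _ hr]
      congr 1
      push_cast
      ring
    have h₃ := h₂ k hk1 (by omega) hkk₀
    have he := (abs_lt.1 (hm 0)).1
    have ha : ∀ i : Fin 4, Int.fract ((k : ℚ) * a i / r) <
        Int.fract ((k₀ : ℚ) * a i / r) + ε := by
      intro i
      have := (abs_lt.1 (hm i.succ)).2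
      rw [Fin.cons_succ, ← hfr] at this
      linarith
    rw [Fin.cons_zero, ← hfr] at he
    have hlt' : ∑ i : Fin 4, Int.fract ((k : ℚ) * (a i : ℚ) / (r : ℚ)) <
        Int.fract ((k : ℚ) * (e : ℚ) / (r : ℚ)) + (k₀ : ℚ) / (r : ℚ) + 5 * ε := by
      rw [Fin.sum_univ_four] at h₁ ⊢
      linarith [ha 0, ha 1, ha 2, ha 3]
    have hlt'' := (Rat.cast_lt (K := ℝ)).2 hlt'
    rw [Rat.cast_add _ (5 * ε), Rat.cast_mul, Rat.cast_ofNat] at hlt''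
    linarith
  refine ⟨hbound, div_pos (by exact_mod_cast hk₀) hr', ?_, ?_⟩
  · rw [div_lt_one hr']
    exact_mod_cast (by omega : k₀ < r)
  · have hd : ((k₀ : ℚ) / r).den ∣ r / Nat.gcd r k₀ := by
      have h := Rat.den_dvd ((k₀ / Nat.gcd r k₀ : ℕ) : ℤ) ((r / Nat.gcd r k₀ : ℕ) : ℤ)
      rw [Int.natCast_dvd_natCast, Rat.divInt_eq_div, Int.cast_natCast, Int.cast_natCast,
        Nat.cast_div_div_div_cancel_right (Nat.gcd_dvd_left r k₀) (Nat.gcd_dvd_right r k₀)] at h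
      exact h
    exact (Nat.le_of_dvd (Nat.div_gcd_pos_of_pos_left k₀ hr) hd).trans hbound
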